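/- Let $\xi$ be an integrable real random variable, and let $h>0$, $c>0$ and $0<y\le h/2$ with $\mathbb{E}(e^{h\xi}\mathbf{1}_{\{\xi>0\}})<\infty$. Then $\mathbb{E}\,e^{y\xi}\le 1+y\,\mathbb{E}\xi+y\,\mathbb{E}\big(|\xi|\,\mathbf{1}_{\{\xi\le -c\}}\big)+\frac{y^2c^2}{2}\,\mathbb{P}(\xi\le 0)+\frac{2y^2}{h^2}\,\mathbb{E}\big(e^{h\xi}\mathbf{1}_{\{\xi>0\}}\big)$. -/

import Mathlib

open MeasureTheory ProbabilityTheory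

theorem exp_le_quadratic_of_nonpos {u : ℝ} (hu : u ≤ 0) :
    Real.exp u ≤ 1 + u + u ^ 2 / 2 := by
  have h1 := Real.quadratic_le_exp_of_nonneg (neg_nonneg.mpr hu)
  have h2 : Real.exp u * Real.exp (-u) = 1 := by rw [← Real.exp_add]; simp
  have h3 : 0 < 1 + u + u ^ 2 / 2 := by nlinarith [sq_nonneg (u + 1)]
  have h4 : (1 + u + u ^ 2 / 2) * (1 + -u + (-u) ^ 2 / 2)
      ≤ (1 + u + u ^ 2 / 2) * Real.exp (-u) := by gcongr
  have h5 : (1 + u + u ^ 2 / 2) * (1 + -u + (-u) ^ 2 / 2) = 1 + (u ^ 2) ^ 2 / 4 := by ring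
  refine le_of_mul_le_mul_right ?_ (Real.exp_pos (-u))
  linarith [sq_nonneg (u ^ 2)]

theorem exp_le_one_add_add_sq_mul_exp {u : ℝ} (hu : 0 ≤ u) :
    Real.exp u ≤ 1 + u + u ^ 2 / 2 * Real.exp u := by
  have hder : ∀ x : ℝ, HasDerivAt (fun x : ℝ => (1 + x) * Real.exp (-x) + x ^ 2 / 2)
      (x * (1 - Real.exp (-x))) x := by
    intro x
    have h := (((hasDerivAt_id x).const_add 1).mul (hasDerivAt_id x).neg.exp).add
      (((hasDerivAt_id x).pow 2).div_const 2)
    refine h.congr_deriv ?_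
    simp
    ring
  have hmono : Monotone (fun x : ℝ => (1 + x) * Real.exp (-x) + x ^ 2 / 2) := by
    refine monotone_of_hasDerivAt_nonneg hder fun x => ?_
    rcases le_total 0 x with hx | hx
    · exact mul_nonneg hx (sub_nonneg.mpr (Real.exp_le_one_iff.mpr (by linarith)))
    · exact mul_nonneg_of_nonpos_of_nonpos hx
        (sub_nonpos.mpr (Real.one_le_exp (by linarith)))
  have h1 := hmono hu
  simp only [add_zero, neg_zero, Real.exp_zero] at h1
  have h2 : Real.exp (-u) * Real.exp u = 1 := by rw [← Real.exp_add]; simp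
  have h3 := mul_le_mul_of_nonneg_right h1 (Real.exp_pos u).le
  have h4 : ((1 + u) * Real.exp (-u) + u ^ 2 / 2) * Real.exp u
      = (1 + u) * (Real.exp (-u) * Real.exp u) + u ^ 2 / 2 * Real.exp u := by ring
  rw [h4, h2] at h3
  linarith

theorem sq_le_exp_of_nonneg {t : ℝ} (ht : 0 ≤ t) : t ^ 2 ≤ Real.exp t := by
  have h1 : t ≤ Real.exp (t / 2) := by
    have := Real.quadratic_le_exp_of_nonneg (div_nonneg ht zero_le_two)
    nlinarith [sq_nonneg (t - 2)]
  have h2 : Real.exp t = Real.exp (t / 2) ^ 2 := by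
    rw [← Real.exp_nat_mul]; congr 1; push_cast; ring
  rw [h2]
  gcongr

theorem exp_mul_le_indicator_bound {h c y : ℝ} (hh : 0 < h) (hy0 : 0 < y)
    (hyh : y ≤ h / 2) (x : ℝ) :
    Real.exp (y * x) ≤ 1 + y * x + y * (Set.Iic (-c)).indicator (fun x => |x|) x
      + y ^ 2 * c ^ 2 / 2 * (Set.Iic (0 : ℝ)).indicator (fun _ => 1) x
      + 2 * y ^ 2 / h ^ 2 * (Set.Ioi (0 : ℝ)).indicator (fun x => Real.exp (h * x)) x := by
  have hind : 0 ≤ (Set.Iic (-c)).indicator (fun x : ℝ => |x|) x :=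
    Set.indicator_nonneg (fun x _ => abs_nonneg x) x
  rcases le_or_gt x 0 with hx | hx
  · have hyx : y * x ≤ 0 := mul_nonpos_of_nonneg_of_nonpos hy0.le hx
    have hx' : x ∉ Set.Ioi (0 : ℝ) := by simpa using hx
    rw [Set.indicator_of_mem (Set.mem_Iic.mpr hx), Set.indicator_of_notMem hx']
    by_cases hxc : x ≤ -c
    · rw [Set.indicator_of_mem (Set.mem_Iic.mpr hxc), abs_of_nonpos hx]
      have := Real.exp_le_one_iff.mpr hyx
      nlinarith [sq_nonneg (y * c)]
    · have h1 := exp_le_quadratic_of_nonpos hyx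
      have h2 : x ^ 2 ≤ c ^ 2 := by nlinarith
      have h3 := mul_le_mul_of_nonneg_left h2 (sq_nonneg y)
      nlinarith [mul_nonneg hy0.le hind]
  · have hx' : x ∉ Set.Iic (0 : ℝ) := by simpa using hx
    rw [Set.indicator_of_notMem hx', Set.indicator_of_mem (Set.mem_Ioi.mpr hx)]
    have h1 := exp_le_one_add_add_sq_mul_exp (mul_nonneg hy0.le hx.le)
    have h2 : Real.exp (y * x) ≤ Real.exp (h / 2 * x) := by gcongr
    have h3 := sq_le_exp_of_nonneg (mul_nonneg (half_pos hh).le hx.le)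
    have h4 : Real.exp (h * x) = Real.exp (h / 2 * x) * Real.exp (h / 2 * x) := by
      rw [← Real.exp_add]; congr 1; ring
    have h5 : (y * x) ^ 2 / 2 * Real.exp (y * x) ≤ 2 * y ^ 2 / h ^ 2 * Real.exp (h * x) :=
      calc (y * x) ^ 2 / 2 * Real.exp (y * x)
          ≤ (y * x) ^ 2 / 2 * Real.exp (h / 2 * x) := by gcongr
        _ = 2 * y ^ 2 / h ^ 2 * ((h / 2 * x) ^ 2 * Real.exp (h / 2 * x)) := by
            field_simp
        _ ≤ 2 * y ^ 2 / h ^ 2 * (Real.exp (h / 2 * x) * Real.exp (h / 2 * x)) := by gcongr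
        _ = 2 * y ^ 2 / h ^ 2 * Real.exp (h * x) := by rw [h4]
    linarith [mul_nonneg hy0.le hind]

/-- Key moment-generating-function estimate (inequality (2) in the paper). -/
theorem mgf_upper_bound
    {Ω : Type*} [MeasurableSpace Ω] (μ : Measure Ω) [IsProbabilityMeasure μ]
    (ξ : Ω → ℝ) (hmeas : Measurable ξ) (hint : Integrable ξ μ)
    (h c y : ℝ) (hh : 0 < h) (hc : 0 < c) (hy0 : 0 < y) (hyh : y ≤ h / 2)
    (hexp : ∫⁻ ω in {ω | 0 < ξ ω}, ENNReal.ofReal (Real.exp (h * ξ ω)) ∂μ < ⊤) :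
    ∫ ω, Real.exp (y * ξ ω) ∂μ ≤
      1 + y * ∫ ω, ξ ω ∂μ + y * ∫ ω in {ω | ξ ω ≤ -c}, |ξ ω| ∂μ
        + y ^ 2 * c ^ 2 / 2 * (μ {ω | ξ ω ≤ 0}).toReal
        + 2 * y ^ 2 / h ^ 2 *
            (∫⁻ ω in {ω | 0 < ξ ω}, ENNReal.ofReal (Real.exp (h * ξ ω)) ∂μ).toReal := by
  have hmA : MeasurableSet {ω | ξ ω ≤ -c} := measurableSet_le hmeas measurable_const
  have hmB : MeasurableSet {ω | ξ ω ≤ 0} := measurableSet_le hmeas measurable_const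
  have hmC : MeasurableSet {ω | 0 < ξ ω} := measurableSet_lt measurable_const hmeas
  have hmexp : Measurable fun ω => Real.exp (h * ξ ω) := (hmeas.const_mul h).exp
  have hpos : ∀ ω, 0 ≤ Real.exp (h * ξ ω) := fun ω => (Real.exp_pos _).le
  have hCon : IntegrableOn (fun ω => Real.exp (h * ξ ω)) {ω | 0 < ξ ω} μ :=
    (lintegral_ofReal_ne_top_iff_integrable hmexp.aestronglyMeasurable
      (Filter.Eventually.of_forall hpos)).mp hexp.ne
  have hA : Integrable ({ω | ξ ω ≤ -c}.indicator fun ω => |ξ ω|) μ :=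
    hint.abs.indicator hmA
  have hB : Integrable ({ω | ξ ω ≤ 0}.indicator fun _ => (1 : ℝ)) μ :=
    (integrable_const 1).indicator hmB
  have hC : Integrable ({ω | 0 < ξ ω}.indicator fun ω => Real.exp (h * ξ ω)) μ :=
    hCon.integrable_indicator hmC
  have h1 : Integrable (fun ω => 1 + y * ξ ω) μ := (integrable_const 1).add (hint.const_mul y)
  have h2 := h1.add (hA.const_mul y)
  have h3 := h2.add (hB.const_mul (y ^ 2 * c ^ 2 / 2))
  have h4 := h3.add (hC.const_mul (2 * y ^ 2 / h ^ 2))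
  have hle := integral_mono_of_nonneg (μ := μ) (f := fun ω => Real.exp (y * ξ ω))
    (Filter.Eventually.of_forall fun ω => (Real.exp_pos _).le) h4
    (Filter.Eventually.of_forall fun ω => exp_mul_le_indicator_bound (c := c) hh hy0 hyh (ξ ω))
  refine hle.trans_eq ?_
  rw [integral_add' h3 (hC.const_mul _), integral_add' h2 (hB.const_mul _),
    integral_add' h1 (hA.const_mul _), integral_add (integrable_const 1) (hint.const_mul y),
    integral_const_mul, integral_const_mul, integral_const_mul, integral_const_mul,
    integral_indicator hmA, integral_indicator hmB, integral_indicator hmC,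
    integral_eq_lintegral_of_nonneg_ae (Filter.Eventually.of_forall hpos)
      hmexp.aestronglyMeasurable]
  simp [Measure.real]
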